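/- There is a constant k_0 ∈ ℕ such that for every k ≥ k_0 and every d with 2k·ln k − ln k − 4 ≤ d ≤ 2k·ln k, the following holds for all sufficiently large n and every near-balanced σ: V → {1,...,k}: in the random multigraph G'(σ), P[min_{1≤i<j≤k} e(V_i,V_j) ≤ 0.99·dn/k²] ≤ exp(−11n/k) and P[max_{1≤i<j≤k} e(V_i,V_j) ≥ 1.01·dn/k²] ≤ exp(−11n/k). -/

import Mathlib

/-- Uniform counting probability on a finite sample space `Ω`. -/
noncomputable def prob {Ω : Type*} (p : Ω → Prop) : ℝ :=
  (Nat.card {x : Ω // p x} : ℝ) / (Nat.card Ω : ℝ)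

/-- The sample space of the random multigraph `G'(σ)`: `m` ordered pairs drawn
uniformly and independently from `{(u,v) : σ u ≠ σ v}`. -/
abbrev CondSpace (n m k : ℕ) (σ : Fin n → Fin k) : Type :=
  {e : Fin m → Fin n × Fin n // ∀ i : Fin m, σ (e i).1 ≠ σ (e i).2}

/-- `e(A,B)`: the number of edges (with multiplicity) with one endpoint in `A`
and the other in `B`. -/
noncomputable def eSet {n m : ℕ} (e : Fin m → Fin n × Fin n) (A B : Set (Fin n)) : ℕ :=
  Nat.card {t : Fin m // ((e t).1 ∈ A ∧ (e t).2 ∈ B) ∨ ((e t).1 ∈ B ∧ (e t).2 ∈ A)}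

/-- `σ` is near-balanced: every color class has size `n/k` up to `n/(k·(ln k)^{1/3})`. -/
def NearBalanced (n k : ℕ) (σ : Fin n → Fin k) : Prop :=
  ∀ i : Fin k,
    |(Nat.card {v : Fin n // σ v = i} : ℝ) - n / k| ≤ n / (k * Real.log k ^ ((1 : ℝ) / 3))

open Classical in
/-- Markov's inequality for the uniform counting probability. -/
lemma prob_le_sum_div_card {Ω : Type*} [Fintype Ω] {p : Ω → Prop} {g : Ω → ℝ}
    (hg : ∀ x, 0 ≤ g x) (hp : ∀ x, p x → 1 ≤ g x) :
    prob p ≤ (∑ x, g x) / Nat.card Ω := by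
  unfold prob
  gcongr
  rw [Nat.card_eq_fintype_card, Fintype.card_subtype, Finset.card_filter, Nat.cast_sum]
  refine Finset.sum_le_sum fun x _ => ?_
  split_ifs with h
  · simpa using hp x h
  · simpa using hg x

open Classical in
/-- The union bound over pairs `i < j`. -/
lemma prob_exists_lt_le {Ω : Type*} [Finite Ω] {k : ℕ} {p : Fin k → Fin k → Ω → Prop} {B : ℝ}
    (hB : 0 ≤ B) (h : ∀ i j, i < j → prob (p i j) ≤ B) :
    prob (fun x => ∃ i j, i < j ∧ p i j x) ≤ k ^ 2 * B := by
  have := Fintype.ofFinite Ω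
  let g : Fin k → Fin k → Ω → ℝ := fun i j x => if i < j ∧ p i j x then 1 else 0
  have hg0 : ∀ i j x, 0 ≤ g i j x := fun i j x => by
    dsimp only [g]; split_ifs <;> norm_num
  have hmain := prob_le_sum_div_card (Ω := Ω) (p := fun x => ∃ i j, i < j ∧ p i j x)
    (g := fun x => ∑ i, ∑ j, g i j x)
    (fun x => Finset.sum_nonneg fun i _ => Finset.sum_nonneg fun j _ => hg0 i j x) (by
      rintro x ⟨i, j, hij⟩
      calc (1 : ℝ) = g i j x := by simp only [g, if_pos hij]
        _ ≤ ∑ j, g i j x := Finset.single_le_sum (fun j _ => hg0 i j x) (Finset.mem_univ j)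
        _ ≤ _ := Finset.single_le_sum (f := fun i => ∑ j, g i j x)
          (fun i _ => Finset.sum_nonneg fun j _ => hg0 i j x) (Finset.mem_univ i))
  have hij : ∀ i j, (∑ x, g i j x) / Nat.card Ω ≤ B := by
    intro i j
    by_cases hlt : i < j
    · refine le_trans (le_of_eq ?_) (h i j hlt)
      unfold prob
      rw [Nat.card_eq_fintype_card (α := {x // p i j x}), Fintype.card_subtype,
        Finset.card_filter, Nat.cast_sum]
      simp [g, hlt]
    · simpa [g, hlt] using hB
  refine hmain.trans ?_
  rw [Finset.sum_comm, Finset.sum_div]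
  calc ∑ i, (∑ x, ∑ j, g i j x) / (Nat.card Ω : ℝ)
      = ∑ i, ∑ j, (∑ x, g i j x) / (Nat.card Ω : ℝ) := by
        refine Finset.sum_congr rfl fun i _ => ?_
        rw [Finset.sum_comm, Finset.sum_div]
    _ ≤ ∑ _i : Fin k, ∑ _j : Fin k, B :=
        Finset.sum_le_sum fun i _ => Finset.sum_le_sum fun j _ => hij i j
    _ = k ^ 2 * B := by simp; ring

/-- The ordered pairs that the edges of `G'(σ)` are drawn from. -/
abbrev BichromaticPair {n k : ℕ} (σ : Fin n → Fin k) : Type :=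
  {p : Fin n × Fin n // σ p.1 ≠ σ p.2}

/-- A pair with one endpoint of colour `i` and the other of colour `j`. -/
def Joins {n k : ℕ} (σ : Fin n → Fin k) (i j : Fin k) (p : Fin n × Fin n) : Prop :=
  (σ p.1 = i ∧ σ p.2 = j) ∨ (σ p.1 = j ∧ σ p.2 = i)

/-- The size of a colour class. -/
noncomputable def classCard {n k : ℕ} (σ : Fin n → Fin k) (i : Fin k) : ℕ :=
  Nat.card {v : Fin n // σ v = i}

open Classical in
lemma card_joins {n k : ℕ} (σ : Fin n → Fin k) {i j : Fin k} (hij : i ≠ j) :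
    (Finset.univ.filter fun p : BichromaticPair σ => Joins σ i j p.1).card =
      2 * (classCard σ i * classCard σ j) := by
  have hmap : (Finset.univ.filter fun p : BichromaticPair σ => Joins σ i j p.1).map
      (Function.Embedding.subtype _) =
      ((Finset.univ.filter fun v => σ v = i) ×ˢ (Finset.univ.filter fun v => σ v = j)) ∪
      ((Finset.univ.filter fun v => σ v = j) ×ˢ (Finset.univ.filter fun v => σ v = i)) := by
    ext ⟨u, v⟩
    simp only [Finset.mem_map, Finset.mem_filter, Finset.mem_univ, true_and,
      Function.Embedding.subtype_apply, Finset.mem_union, Finset.mem_product]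
    constructor
    · rintro ⟨p, hp, h⟩
      rw [h] at hp
      exact hp
    · intro h
      refine ⟨⟨(u, v), ?_⟩, h, rfl⟩
      rcases h with ⟨h1, h2⟩ | ⟨h1, h2⟩
      · simpa [h1, h2] using hij
      · simpa [h1, h2] using hij.symm
  have hdisj : Disjoint
      ((Finset.univ.filter fun v => σ v = i) ×ˢ (Finset.univ.filter fun v => σ v = j))
      ((Finset.univ.filter fun v => σ v = j) ×ˢ (Finset.univ.filter fun v => σ v = i)) := by
    rw [Finset.disjoint_left]
    rintro ⟨u, v⟩ h1 h2
    simp only [Finset.mem_product, Finset.mem_filter, Finset.mem_univ, true_and] at h1 h2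
    exact hij (h1.1.symm.trans h2.1)
  have := congrArg Finset.card hmap
  rw [Finset.card_map, Finset.card_union_of_disjoint hdisj, Finset.card_product,
    Finset.card_product] at this
  rw [this, classCard, classCard, Nat.card_eq_fintype_card, Nat.card_eq_fintype_card,
    Fintype.card_subtype, Fintype.card_subtype]
  ring

open Classical in
/-- The moment generating function of `e(V_i, V_j)`. -/
lemma sum_exp_eSet {n m k : ℕ} (σ : Fin n → Fin k) {i j : Fin k} (hij : i ≠ j) (l : ℝ) :
    ∑ e : CondSpace n m k σ, Real.exp (l * eSet e.1 {v | σ v = i} {v | σ v = j}) =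
      (Nat.card (BichromaticPair σ) +
        2 * (classCard σ i * classCard σ j) * (Real.exp l - 1)) ^ m := by
  have hsum : ∑ p : BichromaticPair σ, (if Joins σ i j p.1 then Real.exp l else 1) =
      Nat.card (BichromaticPair σ) + 2 * (classCard σ i * classCard σ j) * (Real.exp l - 1) := by
    have h1 : ∀ p : BichromaticPair σ, (if Joins σ i j p.1 then Real.exp l else 1) =
        1 + (if Joins σ i j p.1 then (1 : ℝ) else 0) * (Real.exp l - 1) := by
      intro p; split_ifs <;> ring
    simp_rw [h1]
    rw [Finset.sum_add_distrib, ← Finset.sum_mul, Finset.sum_boole, card_joins σ hij]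
    simp
  rw [← hsum, Fintype.sum_pow]
  refine Fintype.sum_equiv
    (Equiv.subtypePiEquivPi (p := fun _ (p : Fin n × Fin n) => σ p.1 ≠ σ p.2)) _ _ fun e => ?_
  have hcard : (eSet e.1 {v | σ v = i} {v | σ v = j} : ℝ) =
      ∑ t, if Joins σ i j (e.1 t) then (1 : ℝ) else 0 := by
    rw [eSet, Nat.card_eq_fintype_card, Fintype.card_subtype, Finset.card_filter, Nat.cast_sum]
    refine Finset.sum_congr rfl fun t _ => ?_
    rw [Nat.cast_ite, Nat.cast_one, Nat.cast_zero]
    exact if_congr Iff.rfl rfl rfl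
  rw [hcard, Finset.mul_sum, Real.exp_sum]
  refine Finset.prod_congr rfl fun t _ => ?_
  simp only [Equiv.subtypePiEquivPi, Equiv.coe_fn_mk]
  by_cases h : Joins σ i j (e.1 t) <;> simp [h]

/-- The Chernoff bound for `e(V_i, V_j)`, covering both tails through the sign of `l`. -/
lemma prob_le_exp {n m k : ℕ} (σ : Fin n → Fin k) {i j : Fin k} (hij : i ≠ j) (l c : ℝ)
    (hN : 0 < Nat.card (BichromaticPair σ)) {p : CondSpace n m k σ → Prop}
    (hp : ∀ e, p e → l * c ≤ l * eSet e.1 {v | σ v = i} {v | σ v = j}) :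
    prob p ≤ Real.exp (-(l * c) + m * (2 * (classCard σ i * classCard σ j) /
      Nat.card (BichromaticPair σ)) * (Real.exp l - 1)) := by
  classical
  have hN' : (0 : ℝ) < Nat.card (BichromaticPair σ) := by exact_mod_cast hN
  have hM := prob_le_sum_div_card (p := p)
    (g := fun e => Real.exp (-(l * c)) * Real.exp (l * eSet e.1 {v | σ v = i} {v | σ v = j}))
    (fun e => by positivity) (fun e he => by
      rw [← Real.exp_add]
      exact Real.one_le_exp (by linarith [hp e he]))
  have hcard : Nat.card (CondSpace n m k σ) = Nat.card (BichromaticPair σ) ^ m := by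
    rw [Nat.card_congr
      (Equiv.subtypePiEquivPi (p := fun _ (p : Fin n × Fin n) => σ p.1 ≠ σ p.2))]
    simp
  rw [← Finset.mul_sum, sum_exp_eSet σ hij, hcard, Nat.cast_pow, mul_div_assoc, ← div_pow] at hM
  refine hM.trans ?_
  rw [Real.exp_add, mul_assoc (m : ℝ), Real.exp_nat_mul]
  set N : ℝ := (Nat.card (BichromaticPair σ) : ℝ)
  have hbase : (N + 2 * (classCard σ i * classCard σ j) * (Real.exp l - 1)) / N =
      2 * (classCard σ i * classCard σ j) / N * (Real.exp l - 1) + 1 := by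
    field_simp; ring
  have hsum := sum_exp_eSet (m := 1) σ hij l
  have hnn : 0 ≤ N + 2 * (classCard σ i * classCard σ j) * (Real.exp l - 1) := by
    rw [pow_one] at hsum
    rw [← hsum]
    positivity
  gcongr
  · rw [hbase]
    exact Real.add_one_le_exp _

lemma card_bichromaticPair_le {n k : ℕ} (σ : Fin n → Fin k) :
    Nat.card (BichromaticPair σ) ≤ n ^ 2 := by
  refine (Nat.card_le_card_of_injective _ Subtype.val_injective).trans ?_
  simp [sq]

lemma le_card_bichromaticPair {n k : ℕ} (σ : Fin n → Fin k) {b : ℝ}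
    (hb : ∀ i, (classCard σ i : ℝ) ≤ b) :
    (n : ℝ) * (n - b) ≤ Nat.card (BichromaticPair σ) := by
  classical
  have hcompl : Fintype.card {p : Fin n × Fin n // σ p.1 = σ p.2} =
      ∑ u, classCard σ (σ u) := by
    rw [Fintype.card_subtype, Finset.card_filter, Fintype.sum_prod_type]
    refine Finset.sum_congr rfl fun u _ => ?_
    rw [← Finset.card_filter, classCard, Nat.card_eq_fintype_card, Fintype.card_subtype]
    congr 1
    ext v
    simp [eq_comm]
  have hadd := Fintype.card_subtype_compl (fun p : Fin n × Fin n => σ p.1 = σ p.2)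
  have hle := Fintype.card_subtype_le (fun p : Fin n × Fin n => σ p.1 = σ p.2)
  have htot : Nat.card (BichromaticPair σ) + ∑ u, classCard σ (σ u) = n * n := by
    rw [Nat.card_eq_fintype_card, ← hcompl]
    simp only [Fintype.card_prod, Fintype.card_fin] at hadd hle
    change Fintype.card {p : Fin n × Fin n // ¬ (σ p.1 = σ p.2)} + _ = _
    omega
  have hsum : ((∑ u, classCard σ (σ u) : ℕ) : ℝ) ≤ n * b := by
    push_cast
    calc ∑ u, (classCard σ (σ u) : ℝ) ≤ ∑ _u : Fin n, b := Finset.sum_le_sum fun u _ => hb _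
      _ = n * b := by simp
  have htot' : (Nat.card (BichromaticPair σ) : ℝ) + (∑ u, classCard σ (σ u) : ℕ) = n * n := by
    exact_mod_cast htot
  linarith

/-- If the class sizes and the number of edges are within `10⁻⁵` of their nominal values, the
expectation of `e(V_i, V_j)` is within `10⁻³` of `dn/k²`. -/
lemma expectation_bounds {n k d m a b N : ℝ} (hn : 0 < n) (hk : 0 < k) (hd : 0 < d)
    (hm : d * n / 2 ≤ m) (hm' : m ≤ 1.00001 * (d * n / 2))
    (ha : 0.99999 * (n / k) ≤ a) (ha' : a ≤ 1.00001 * (n / k))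
    (hb : 0.99999 * (n / k) ≤ b) (hb' : b ≤ 1.00001 * (n / k))
    (hN : 0.99999 * n ^ 2 ≤ N) (hN' : N ≤ n ^ 2) :
    0.999 * (d * n / k ^ 2) ≤ m * (2 * (a * b) / N) ∧
      m * (2 * (a * b) / N) ≤ 1.001 * (d * n / k ^ 2) := by
  have hN0 : 0 < N := lt_of_lt_of_le (by positivity) hN
  have ha0 : 0 < a := lt_of_lt_of_le (by positivity) ha
  have hb0 : 0 < b := lt_of_lt_of_le (by positivity) hb
  have hμ : 0 < d * n / k ^ 2 := by positivity
  have hm0 : 0 ≤ m := le_trans (by positivity) hm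
  constructor
  · calc 0.999 * (d * n / k ^ 2) ≤ 0.99999 ^ 2 * (d * n / k ^ 2) := by
          apply mul_le_mul_of_nonneg_right _ hμ.le; norm_num
      _ = d * n / 2 * (2 * (0.99999 * (n / k) * (0.99999 * (n / k))) / n ^ 2) := by
          field_simp
      _ ≤ m * (2 * (a * b) / N) := by gcongr
  · calc m * (2 * (a * b) / N)
        ≤ 1.00001 * (d * n / 2) *
          (2 * (1.00001 * (n / k) * (1.00001 * (n / k))) / (0.99999 * n ^ 2)) := by
          gcongr
      _ = 1.00001 ^ 3 / 0.99999 * (d * n / k ^ 2) := by field_simp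
      _ ≤ 1.001 * (d * n / k ^ 2) := by
          apply mul_le_mul_of_nonneg_right _ hμ.le; norm_num

lemma exp_sub_one_le_add_sq {l : ℝ} (hl : |l| ≤ 1) : Real.exp l - 1 ≤ l + l ^ 2 := by
  have := (abs_le.mp (Real.abs_exp_sub_one_sub_id_le hl)).2
  linarith

lemma upper_exponent_le {μ M : ℝ} (hμ : 0 ≤ μ) (hM : M ≤ 1.001 * μ) :
    -(0.001 * (1.01 * μ)) + M * (Real.exp 0.001 - 1) ≤ -(0.000007 * μ) := by
  have h := exp_sub_one_le_add_sq (l := 0.001) (by norm_num [abs_le])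
  have h0 : 0 ≤ Real.exp 0.001 - 1 := by
    linarith [Real.add_one_le_exp (0.001 : ℝ)]
  have h1 : M * (Real.exp 0.001 - 1) ≤ 1.001 * μ * (0.001 + 0.001 ^ 2) := by gcongr
  norm_num at h1 ⊢
  linarith

lemma lower_exponent_le {μ M : ℝ} (hμ : 0 ≤ μ) (hM : 0.999 * μ ≤ M) :
    -(-0.001 * (0.99 * μ)) + M * (Real.exp (-0.001) - 1) ≤ -(0.000007 * μ) := by
  have h := exp_sub_one_le_add_sq (l := -0.001) (by norm_num [abs_le])
  have hM0 : 0 ≤ M := le_trans (by positivity) hM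
  have h1 : M * (Real.exp (-0.001) - 1) ≤ M * (-0.001 + (-0.001) ^ 2) := by gcongr
  norm_num at h1 ⊢
  linarith

lemma nearBalanced_bounds {n k : ℕ} {σ : Fin n → Fin k} (hσ : NearBalanced n k σ)
    (hL : (10 : ℝ) ^ 15 ≤ Real.log k) (i : Fin k) :
    0.99999 * ((n : ℝ) / k) ≤ classCard σ i ∧ (classCard σ i : ℝ) ≤ 1.00001 * (n / k) := by
  have hroot : (10 : ℝ) ^ 5 ≤ Real.log k ^ ((1 : ℝ) / 3) := by
    have h := Real.rpow_le_rpow (by positivity) hL (by norm_num : (0 : ℝ) ≤ 1 / 3)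
    have h15 : ((10 : ℝ) ^ 15) ^ ((1 : ℝ) / 3) = 10 ^ 5 := by
      rw [← Real.rpow_natCast, ← Real.rpow_mul (by norm_num)]
      norm_num [← Real.rpow_natCast]
    rwa [h15] at h
  have herr : (n : ℝ) / (k * Real.log k ^ ((1 : ℝ) / 3)) ≤ 0.00001 * (n / k) := by
    rw [← div_div]
    calc (n : ℝ) / k / Real.log k ^ ((1 : ℝ) / 3) ≤ n / k / 10 ^ 5 := by gcongr
      _ = 0.00001 * (n / k) := by ring
  have h := abs_le.mp ((hσ i).trans herr)
  change -(0.00001 * ((n : ℝ) / k)) ≤ (classCard σ i : ℝ) - n / k ∧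
    (classCard σ i : ℝ) - n / k ≤ 0.00001 * (n / k) at h
  constructor <;> linarith [h.1, h.2]

theorem statement10 :
    ∃ k₀ : ℕ, ∀ k : ℕ, k₀ ≤ k → ∀ d : ℝ,
      2 * k * Real.log k - Real.log k - 4 ≤ d → d ≤ 2 * k * Real.log k →
      ∃ n₀ : ℕ, ∀ n : ℕ, n₀ ≤ n → ∀ σ : Fin n → Fin k, NearBalanced n k σ →
        prob (fun e : CondSpace n ⌈d * n / 2⌉₊ k σ =>
            ∃ i j : Fin k, i < j ∧
              (eSet e.1 {v | σ v = i} {v | σ v = j} : ℝ) ≤ 0.99 * d * n / k ^ 2)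
          ≤ Real.exp (-11 * n / k) ∧
        prob (fun e : CondSpace n ⌈d * n / 2⌉₊ k σ =>
            ∃ i j : Fin k, i < j ∧
              1.01 * d * n / k ^ 2 ≤ (eSet e.1 {v | σ v = i} {v | σ v = j} : ℝ))
          ≤ Real.exp (-11 * n / k) := by
  obtain ⟨k₀, hk₀⟩ := Filter.eventually_atTop.mp
    ((Real.tendsto_log_atTop.comp tendsto_natCast_atTop_atTop).eventually_ge_atTop
      ((10 : ℝ) ^ 15))
  refine ⟨max k₀ (10 ^ 6), fun k hk d hd _ => ?_⟩
  have hL : (10 : ℝ) ^ 15 ≤ Real.log k := hk₀ k (le_trans (le_max_left _ _) hk)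
  have hk6 : (10 : ℝ) ^ 6 ≤ k := by exact_mod_cast le_trans (le_max_right _ _) hk
  have hk0 : (0 : ℝ) < k := lt_of_lt_of_le (by norm_num) hk6
  have hdL : k * Real.log k ≤ d := by nlinarith
  have hd6 : (10 : ℝ) ^ 6 ≤ d := by nlinarith
  have hd0 : 0 < d := lt_of_lt_of_le (by norm_num) hd6
  refine ⟨⌈2 * k * Real.log k⌉₊, fun n hn σ hσ => ?_⟩
  have hnL : 2 * k * Real.log k ≤ n := (Nat.le_ceil _).trans (by exact_mod_cast hn)
  have hn1 : (1 : ℝ) ≤ n := by nlinarith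
  have hn0 : (0 : ℝ) < n := by linarith
  have hm := Nat.le_ceil (d * n / 2)
  have hm' : (⌈d * n / 2⌉₊ : ℝ) ≤ 1.00001 * (d * n / 2) := by
    have := (Nat.ceil_lt_add_one (by positivity : 0 ≤ d * n / 2)).le
    nlinarith
  have hcls := nearBalanced_bounds hσ hL
  have hN : 0.99999 * (n : ℝ) ^ 2 ≤ Nat.card (BichromaticPair σ) := by
    refine le_trans ?_ (le_card_bichromaticPair σ fun i => (hcls i).2)
    have : (n : ℝ) / k ≤ n / 10 ^ 6 := by gcongr
    nlinarith
  have hN' : (Nat.card (BichromaticPair σ) : ℝ) ≤ (n : ℝ) ^ 2 := by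
    exact_mod_cast card_bichromaticPair_le σ
  have hNpos : 0 < Nat.card (BichromaticPair σ) := by
    have : (0 : ℝ) < Nat.card (BichromaticPair σ) := lt_of_lt_of_le (by positivity) hN
    exact_mod_cast this
  set μ : ℝ := d * n / k ^ 2 with hμ
  have hμ0 : 0 ≤ μ := by positivity
  have hexp := fun i j => expectation_bounds hn0 hk0 hd0 hm hm' (hcls i).1 (hcls i).2
    (hcls j).1 (hcls j).2 hN hN'
  have hfinal : (k : ℝ) ^ 2 * Real.exp (-(0.000007 * μ)) ≤ Real.exp (-11 * n / k) := by
    have hk2 : (k : ℝ) ^ 2 = Real.exp (2 * Real.log k) := by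
      rw [two_mul, Real.exp_add, Real.exp_log hk0, sq]
    rw [hk2, ← Real.exp_add]
    apply Real.exp_le_exp.mpr
    have hx : 2 * Real.log k ≤ n / k := by
      rw [le_div_iff₀ hk0]; linarith
    have hμx : Real.log k * (n / k) ≤ μ := by
      have : Real.log k * (n / k) = k * Real.log k * n / k ^ 2 := by field_simp
      rw [this, hμ]
      gcongr
    have h12 : 12 * ((n : ℝ) / k) ≤ 0.000007 * μ := by
      have : (10 : ℝ) ^ 15 * (n / k) ≤ Real.log k * (n / k) := by gcongr
      have : (0 : ℝ) ≤ n / k := by positivity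
      linarith
    rw [mul_div_assoc]
    linarith
  constructor
  · refine (prob_exists_lt_le (Real.exp_nonneg _) fun i j hij => ?_).trans hfinal
    refine (prob_le_exp σ hij.ne (-0.001) (0.99 * μ) hNpos fun e he => ?_).trans
      (Real.exp_le_exp.mpr (lower_exponent_le hμ0 (hexp i j).1))
    have : 0.99 * d * n / k ^ 2 = 0.99 * μ := by rw [hμ]; ring
    linarith
  · refine (prob_exists_lt_le (Real.exp_nonneg _) fun i j hij => ?_).trans hfinal
    refine (prob_le_exp σ hij.ne 0.001 (1.01 * μ) hNpos fun e he => ?_).trans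
      (Real.exp_le_exp.mpr (upper_exponent_le hμ0 (hexp i j).2))
    have : 1.01 * d * n / k ^ 2 = 1.01 * μ := by rw [hμ]; ring
    linarith
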